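/- arXiv:2312.13588 — 2 statements merged into one kernel-verified Lean document; each statement's English description precedes it below -/
import Mathlib

section
/- (Dual Lemma) Let k ≥ 2 and let α ∈ F_2^k with α ∉ {𝟎, 𝟏}, where 𝟎 and 𝟏 denote the all-zeros and all-ones vectors. Then f_α(n) ~ f_{α+𝟏}(n), i.e., the limit as n → ∞ of f_α(n)/f_{α+𝟏}(n) equals 1. -/
open Finset

/-- A family `F` of subsets of `Fin n` satisfies the `α`-intersection pattern modulo 2
(for `α = (α_1, …, α_k)`, here 0-indexed: `α i` governs intersections of `i+1` distinct sets)
if every subfamily of `i+1` distinct sets has intersection of size `≡ α_i (mod 2)`. -/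
def SatisfiesPattern (n k : ℕ) (α : Fin k → ZMod 2) (F : Finset (Finset (Fin n))) : Prop :=
  ∀ i : Fin k, ∀ S : Finset (Finset (Fin n)), S ⊆ F → S.card = i.val + 1 →
    ((S.inf id).card : ZMod 2) = α i

/-- `maxPattern k α n` is `f_α(n)`, the maximum size of a family of subsets of `[n]`
satisfying the `α`-intersection pattern modulo 2. -/
noncomputable def maxPattern (k : ℕ) (α : Fin k → ZMod 2) (n : ℕ) : ℕ :=
  sSup {m : ℕ | ∃ F : Finset (Finset (Fin n)), SatisfiesPattern n k α F ∧ F.card = m}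

/-- Indexed, algebraic version of the intersection pattern. -/
def IndPat {V ι : Type} [Fintype V] (k : ℕ) (α : Fin k → ZMod 2) (A : ι → V → ZMod 2) : Prop :=
  ∀ i : Fin k, ∀ S : Finset ι, S.card = i.val + 1 → ∑ v, ∏ x ∈ S, A x v = α i

theorem zmod2_cases (a : ZMod 2) : a = 0 ∨ a = 1 := by
  revert a; decide

theorem zmod2_mul_self (a : ZMod 2) : a * a = a := by
  revert a; decide

theorem zmod2_add_self (a : ZMod 2) : a + a = 0 := by
  revert a; decide

theorem zmod2_add_of_ne (a b : ZMod 2) (h : a ≠ b) : a + b = 1 := by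
  revert a b; decide

theorem zmod2_pow (a : ZMod 2) (j : ℕ) (hj : j ≠ 0) : a ^ j = a := by
  rcases zmod2_cases a with rfl | rfl
  · simp [hj]
  · simp

theorem exists_adjacent (k : ℕ) (α : Fin k → ZMod 2)
    (h0 : α ≠ fun _ => 0) (h1 : α ≠ fun _ => 1) :
    ∃ (j : ℕ) (h : j + 1 < k), α ⟨j, by omega⟩ ≠ α ⟨j + 1, h⟩ := by
  by_contra hcon
  push Not at hcon
  rcases Nat.eq_zero_or_pos k with hk | hk
  · subst hk
    exact h0 (funext fun i => i.elim0)
  have key : ∀ (j : ℕ) (h : j < k), α ⟨j, h⟩ = α ⟨0, hk⟩ := by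
    intro j
    induction j with
    | zero => intro h; rfl
    | succ j ih =>
      intro h
      rw [← hcon j h]
      exact ih (by omega)
  rcases zmod2_cases (α ⟨0, hk⟩) with h | h
  · exact h0 (funext fun i => by rw [← h]; exact key i.1 i.2)
  · exact h1 (funext fun i => by rw [← h]; exact key i.1 i.2)

theorem IndPat.injective {V ι : Type} [Fintype V] [Fintype ι] {k : ℕ} {α : Fin k → ZMod 2}
    {A : ι → V → ZMod 2} (hA : IndPat k α A) (h0 : α ≠ fun _ => 0) (h1 : α ≠ fun _ => 1)
    (hc : k ≤ Fintype.card ι) : Function.Injective A := by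
  classical
  intro x y hxy
  by_contra hne
  obtain ⟨j, hj, hjne⟩ := exists_adjacent k α h0 h1
  have hcard : j ≤ ((univ : Finset ι) \ {x, y}).card := by
    have h2 := Finset.le_card_sdiff ({x, y} : Finset ι) univ
    rw [Finset.card_pair hne, Finset.card_univ] at h2
    omega
  obtain ⟨T, hT, hTc⟩ := Finset.exists_subset_card_eq hcard
  have hx : x ∉ T := fun h => by have := hT h; simp at this
  have hy : y ∉ insert x T := by
    intro h
    rcases Finset.mem_insert.1 h with h | h
    · exact hne h.symm
    · have := hT h; simp at this
  have e1 := hA ⟨j, by omega⟩ (insert x T) (by rw [Finset.card_insert_of_notMem hx, hTc])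
  have e2 := hA ⟨j + 1, hj⟩ (insert y (insert x T))
    (by rw [Finset.card_insert_of_notMem hy, Finset.card_insert_of_notMem hx, hTc])
  apply hjne
  rw [← e1, ← e2]
  refine Finset.sum_congr rfl fun v _ => ?_
  rw [Finset.prod_insert hy, Finset.prod_insert hx, ← hxy, ← mul_assoc, zmod2_mul_self]

theorem sum_prod_indicator {n : ℕ} (S : Finset (Finset (Fin n))) :
    ((S.inf id).card : ZMod 2) = ∑ v, ∏ s ∈ S, (if v ∈ s then (1 : ZMod 2) else 0) := by
  have h : ∀ v, (∏ s ∈ S, (if v ∈ s then (1 : ZMod 2) else 0)) =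
      if v ∈ S.inf id then 1 else 0 := by
    intro v
    rw [Finset.prod_ite_zero]
    simp [Finset.mem_inf]
  simp only [h]
  simp

theorem bddAbove_pattern (k : ℕ) (α : Fin k → ZMod 2) (n : ℕ) :
    BddAbove {m : ℕ | ∃ F : Finset (Finset (Fin n)), SatisfiesPattern n k α F ∧ F.card = m} := by
  refine ⟨Fintype.card (Finset (Fin n)), ?_⟩
  rintro m ⟨F, -, rfl⟩
  exact Finset.card_le_univ F

theorem le_maxPattern {V ι : Type} [Fintype V] [Fintype ι] {k : ℕ} {α : Fin k → ZMod 2}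
    {A : ι → V → ZMod 2} (hA : IndPat k α A) (h0 : α ≠ fun _ => 0) (h1 : α ≠ fun _ => 1)
    (hc : k ≤ Fintype.card ι) {n : ℕ} (hn : Fintype.card V = n) :
    Fintype.card ι ≤ maxPattern k α n := by
  classical
  let e : V ≃ Fin n := Fintype.equivFinOfCardEq hn
  let G : ι → Finset (Fin n) := fun x => univ.filter fun v => A x (e.symm v) = 1
  have hG : ∀ x v, (if v ∈ G x then (1 : ZMod 2) else 0) = A x (e.symm v) := by
    intro x v
    rcases zmod2_cases (A x (e.symm v)) with h | h <;> simp [G, h]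
  have hGi : Function.Injective G := by
    intro x y hxy
    apply hA.injective h0 h1 hc
    funext v
    have := hG x (e v)
    rw [hxy, hG] at this
    simpa using this.symm
  apply le_csSup (bddAbove_pattern k α n)
  refine ⟨univ.image G, ?_, ?_⟩
  · intro i S hS hcard
    obtain ⟨T, -, rfl⟩ := Finset.subset_image_iff.1 hS
    rw [Finset.card_image_of_injective _ hGi] at hcard
    rw [sum_prod_indicator, ← hA i T hcard, ← Equiv.sum_comp e.symm]
    refine Finset.sum_congr rfl fun v _ => ?_
    rw [Finset.prod_image (fun a _ b _ h => hGi h)]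
    exact Finset.prod_congr rfl fun x _ => hG x v
  · rw [Finset.card_image_of_injective _ hGi, Finset.card_univ]

theorem exists_indPat (k : ℕ) (α : Fin k → ZMod 2) (n : ℕ) :
    ∃ (F : Finset (Finset (Fin n))) (A : F → Fin n → ZMod 2),
      F.card = maxPattern k α n ∧ IndPat k α A ∧ Function.Injective A := by
  classical
  have hne : {m : ℕ | ∃ F : Finset (Finset (Fin n)),
      SatisfiesPattern n k α F ∧ F.card = m}.Nonempty := by
    refine ⟨0, ∅, ?_, rfl⟩
    intro i S hS hc
    rw [Finset.subset_empty.1 hS] at hc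
    simp at hc
  obtain ⟨F, hF, hc⟩ := Nat.sSup_mem hne (bddAbove_pattern k α n)
  refine ⟨F, fun s v => if v ∈ s.1 then 1 else 0, hc, ?_, ?_⟩
  · intro i S hS
    have := hF i (S.map (Function.Embedding.subtype _)) (by
      intro s hs
      obtain ⟨t, -, rfl⟩ := Finset.mem_map.1 hs
      exact t.2) (by rw [Finset.card_map, hS])
    rw [sum_prod_indicator] at this
    rw [← this]
    refine Finset.sum_congr rfl fun v _ => ?_
    rw [Finset.prod_map]
    rfl
  · intro s t hst
    apply Subtype.ext
    ext v
    have := congrFun hst v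
    by_cases h1 : v ∈ s.1 <;> by_cases h2 : v ∈ t.1 <;> simp_all

/-- Adding one point to all sets flips the pattern. -/
theorem maxPattern_le_flip (k : ℕ) (α : Fin k → ZMod 2)
    (h0 : α ≠ fun _ => 0) (h1 : α ≠ fun _ => 1) (n : ℕ) (hn : k ≤ maxPattern k α n) :
    maxPattern k α n ≤ maxPattern k (fun i => α i + 1) (n + 1) := by
  obtain ⟨F, A, hc, hA, -⟩ := exists_indPat k α n
  have hc' : Fintype.card F = maxPattern k α n := by rw [Fintype.card_coe, hc]
  rw [← hc'] at hn ⊢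
  refine le_maxPattern (V := Option (Fin n))
    (A := fun x v => Option.elim v 1 (A x)) ?_ ?_ ?_ hn (by simp)
  · intro i S hS
    rw [Fintype.sum_option]
    simp only [Option.elim, Finset.prod_const_one]
    rw [hA i S hS, add_comm]
  · intro h
    apply h1
    funext i
    have := congrFun h i
    try simp only at this
    revert this; generalize α i = a; revert a; decide
  · intro h
    apply h0
    funext i
    have := congrFun h i
    try simp only at this
    revert this; generalize α i = a; revert a; decide

/-- Deleting one point at the cost of two sets. -/
theorem IndPat.shrink {V ι : Type} [Fintype V] [DecidableEq V] [DecidableEq ι]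
    {k : ℕ} {α : Fin k → ZMod 2}
    {A : ι → V → ZMod 2} (hA : IndPat k α A) (g h : ι) (a : V) (hgh : A g a ≠ A h a) :
    IndPat k α (fun (x : {x : ι // x ≠ g ∧ x ≠ h}) (v : {v : V // v ≠ a}) =>
      A x v + A x a * (A g v + A h v)) := by
  intro i S hS
  set T : Finset ι := S.map (Function.Embedding.subtype _) with hT
  have hTc : T.card = i.val + 1 := by rw [hT, Finset.card_map, hS]
  have hgT : g ∉ T := by
    intro hm
    obtain ⟨t, -, ht⟩ := Finset.mem_map.1 hm
    exact t.2.1 ht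
  have hhT : h ∉ T := by
    intro hm
    obtain ⟨t, -, ht⟩ := Finset.mem_map.1 hm
    exact t.2.2 ht
  have step1 : ∀ v : V, ∏ x ∈ S, (A x v + A x a * (A g v + A h v)) =
      ∏ x ∈ T, (A x v + A x a * (A g v + A h v)) := by
    intro v
    rw [hT, Finset.prod_map]
    rfl
  have step2 : ∑ v : {v : V // v ≠ a}, ∏ x ∈ T, (A x v + A x a * (A g v + A h v)) =
      ∑ v : V, ∏ x ∈ T, (A x v + A x a * (A g v + A h v)) := by
    have hTne : T.Nonempty := by rw [← Finset.card_pos]; omega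
    obtain ⟨x, hx⟩ := hTne
    have hz : ∏ x ∈ T, (A x a + A x a * (A g a + A h a)) = 0 := by
      apply Finset.prod_eq_zero hx
      rw [zmod2_add_of_ne _ _ hgh, mul_one, zmod2_add_self]
    rw [← Finset.add_sum_erase univ _ (Finset.mem_univ a), hz, zero_add]
    exact (Finset.sum_subtype (univ.erase a) (p := fun v => v ≠ a) (by simp)
      (fun v => ∏ x ∈ T, (A x v + A x a * (A g v + A h v)))).symm
  have step3 : ∀ t ∈ T.powerset, t ≠ T →
      ∑ v, (∏ x ∈ t, A x v) * ∏ x ∈ T \ t, (A x a * (A g v + A h v)) = 0 := by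
    intro t ht htT
    have hsub := Finset.mem_powerset.1 ht
    have hss : t ⊂ T := lt_of_le_of_ne hsub htT
    have hlt := Finset.card_lt_card hss
    have hd : (T \ t).card ≠ 0 := by
      rw [Finset.card_sdiff_of_subset hsub]; omega
    have hgt : g ∉ t := fun hm => hgT (hsub hm)
    have hht : h ∉ t := fun hm => hhT (hsub hm)
    have eg := hA ⟨t.card, by omega⟩ (insert g t) (by rw [Finset.card_insert_of_notMem hgt])
    have eh := hA ⟨t.card, by omega⟩ (insert h t) (by rw [Finset.card_insert_of_notMem hht])
    have : ∀ v, (∏ x ∈ t, A x v) * ∏ x ∈ T \ t, (A x a * (A g v + A h v)) =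
        (∏ x ∈ T \ t, A x a) * (∏ x ∈ insert g t, A x v) +
        (∏ x ∈ T \ t, A x a) * (∏ x ∈ insert h t, A x v) := by
      intro v
      rw [Finset.prod_mul_distrib, Finset.prod_const, zmod2_pow _ _ hd,
        Finset.prod_insert hgt, Finset.prod_insert hht]
      ring
    simp only [this]
    rw [Finset.sum_add_distrib, ← Finset.mul_sum, ← Finset.mul_sum, eg, eh, zmod2_add_self]
  simp only [step1]
  rw [step2]
  simp only [Finset.prod_add]
  rw [Finset.sum_comm, Finset.sum_eq_single T step3]
  · simpa using hA i T hTc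
  · intro hm; simp at hm

theorem maxPattern_succ_le (k : ℕ) (hk : 2 ≤ k) (α : Fin k → ZMod 2)
    (h0 : α ≠ fun _ => 0) (h1 : α ≠ fun _ => 1) (n : ℕ) (hn : k + 2 ≤ maxPattern k α (n + 1)) :
    maxPattern k α (n + 1) ≤ maxPattern k α n + 2 := by
  classical
  obtain ⟨F, A, hc, hA, hinj⟩ := exists_indPat k α (n + 1)
  have hc' : Fintype.card F = maxPattern k α (n + 1) := by rw [Fintype.card_coe, hc]
  rw [← hc'] at hn ⊢
  obtain ⟨g, h, hgh⟩ := Fintype.exists_pair_of_one_lt_card (α := F) (by omega)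
  have hne : A g ≠ A h := fun e => hgh (hinj e)
  obtain ⟨a, ha⟩ := Function.ne_iff.1 hne
  have hs := hA.shrink g h a ha
  have hcard : Fintype.card {x : F // x ≠ g ∧ x ≠ h} = Fintype.card F - 2 := by
    rw [Fintype.card_subtype]
    have : (univ.filter fun x : F => x ≠ g ∧ x ≠ h) = univ \ {g, h} := by
      ext x; simp
    rw [this, Finset.card_sdiff_of_subset (Finset.subset_univ _), Finset.card_pair hgh,
      Finset.card_univ]
  have := le_maxPattern hs h0 h1 (by omega) (n := n) (by simp)
  omega

/-- The Möbius construction: arbitrary patterns are realizable. -/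
theorem exists_large (k : ℕ) (α : Fin k → ZMod 2) (m : ℕ) :
    ∃ A : Fin m → Finset (Fin m) → ZMod 2, IndPat k α A := by
  classical
  let β : Finset (Fin m) → ZMod 2 := fun W =>
    if h : W.card - 1 < k then α ⟨W.card - 1, h⟩ else 0
  let c : Finset (Fin m) → ZMod 2 := fun U => ∑ W, if U ⊆ W then β W else 0
  refine ⟨fun x U => if x ∈ U then c U else 0, ?_⟩
  intro i S hS
  have hSne : S.card ≠ 0 := by omega
  have hβ : β S = α i := by
    have : S.card - 1 = i.val := by omega
    simp [β, this]
  rw [← hβ]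
  have h1 : ∀ U : Finset (Fin m), ∏ x ∈ S, (if x ∈ U then c U else 0) =
      ∑ W, if S ⊆ U ∧ U ⊆ W then β W else 0 := by
    intro U
    rw [Finset.prod_ite_zero, Finset.prod_const, zmod2_pow _ _ hSne]
    by_cases h : S ⊆ U
    · rw [if_pos (fun x hx => h hx)]
      simp [h, c]
    · rw [if_neg (fun h' => h fun x hx => h' x hx)]
      simp [h]
  simp only [h1]
  rw [Finset.sum_comm]
  rw [Finset.sum_eq_single S]
  · rw [Finset.sum_eq_single S]
    · simp
    · intro U _ hU
      rw [if_neg]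
      rintro ⟨ha, hb⟩
      exact hU (Finset.Subset.antisymm hb ha)
    · simp
  · intro W _ hW
    rw [← Finset.sum_filter, Finset.sum_const]
    by_cases hSW : S ⊆ W
    · have : (univ.filter fun U => S ⊆ U ∧ U ⊆ W) = Finset.Icc S W := by
        ext U; simp
      rw [this, Finset.card_Icc_finset hSW]
      have hlt := Finset.card_lt_card (lt_of_le_of_ne hSW hW.symm : S ⊂ W)
      obtain ⟨d, hd⟩ : ∃ d, W.card - S.card = d + 1 := ⟨W.card - S.card - 1, by omega⟩
      rw [hd, pow_succ, mul_smul, two_smul, zmod2_add_self, smul_zero]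
    · have : (univ.filter fun U => S ⊆ U ∧ U ⊆ W) = ∅ := by
        ext U
        simp only [Finset.mem_filter, Finset.mem_univ, true_and, Finset.notMem_empty, iff_false]
        rintro ⟨ha, hb⟩
        exact hSW (ha.trans hb)
      rw [this]; simp
  · simp

theorem maxPattern_tendsto (k : ℕ) (α : Fin k → ZMod 2)
    (h0 : α ≠ fun _ => 0) (h1 : α ≠ fun _ => 1) :
    Filter.Tendsto (maxPattern k α) Filter.atTop Filter.atTop := by
  rw [Filter.tendsto_atTop]
  intro b
  filter_upwards [Filter.eventually_ge_atTop (2 ^ (b + k))] with n hn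
  obtain ⟨A, hA⟩ := exists_large k α (b + k)
  have := le_maxPattern (V := Finset (Fin (b + k)) ⊕ Fin (n - 2 ^ (b + k)))
    (A := fun x v => Sum.elim (A x) (fun _ => 0) v) (k := k) (α := α) (n := n) (by
      intro i S hS
      rw [Fintype.sum_sum_type]
      have hSne : S.card ≠ 0 := by omega
      simp only [Sum.elim_inl, Sum.elim_inr, Finset.prod_const]
      rw [hA i S hS]
      simp [hSne]) h0 h1 (by simp) (by simp; omega)
  simp at this
  omega

theorem dual_lemma (k : ℕ) (hk : 2 ≤ k) (α : Fin k → ZMod 2)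
    (h0 : α ≠ fun _ => 0) (h1 : α ≠ fun _ => 1) :
    Filter.Tendsto
      (fun n : ℕ => (maxPattern k α n : ℝ) / (maxPattern k (fun i => α i + 1) n : ℝ))
      Filter.atTop (nhds 1) := by
  have g0 : (fun i => α i + 1) ≠ fun _ => 0 := by
    intro h
    apply h1
    funext i
    have := congrFun h i
    try simp only at this
    revert this; generalize α i = a; revert a; decide
  have g1 : (fun i => α i + 1) ≠ fun _ => 1 := by
    intro h
    apply h0
    funext i
    have := congrFun h i
    try simp only at this
    revert this; generalize α i = a; revert a; decide
  have hff : (fun i => (fun i => α i + 1) i + 1) = α := by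
    funext i
    simp only
    generalize α i = a; revert a; decide
  have ta := maxPattern_tendsto k α h0 h1
  have tb := maxPattern_tendsto k _ g0 g1
  have key : ∀ᶠ n in Filter.atTop,
      maxPattern k α n ≤ maxPattern k (fun i => α i + 1) n + 2 ∧
      maxPattern k (fun i => α i + 1) n ≤ maxPattern k α n + 2 ∧
      0 < maxPattern k (fun i => α i + 1) n := by
    have ta1 := (Filter.tendsto_add_atTop_iff_nat 1).2 ta
    have tb1 := (Filter.tendsto_add_atTop_iff_nat 1).2 tb
    filter_upwards [ta.eventually_ge_atTop (k + 2), tb.eventually_ge_atTop (k + 2),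
      ta1.eventually_ge_atTop (k + 2), tb1.eventually_ge_atTop (k + 2)] with n e1 e2 e3 e4
    have s1 := maxPattern_le_flip k α h0 h1 n (by omega)
    have s2 := maxPattern_succ_le k hk _ g0 g1 n e4
    have s3 := maxPattern_le_flip k _ g0 g1 n (by omega)
    rw [hff] at s3
    have s4 := maxPattern_succ_le k hk α h0 h1 n e3
    exact ⟨by omega, by omega, by omega⟩
  have tb' : Filter.Tendsto (fun n => (maxPattern k (fun i => α i + 1) n : ℝ))
      Filter.atTop Filter.atTop := tendsto_natCast_atTop_atTop.comp tb
  have tz : Filter.Tendsto (fun n => (2 : ℝ) / (maxPattern k (fun i => α i + 1) n : ℝ))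
      Filter.atTop (nhds 0) := tb'.const_div_atTop 2
  rw [tendsto_iff_dist_tendsto_zero]
  refine squeeze_zero' (Filter.Eventually.of_forall fun _ => dist_nonneg) ?_ tz
  filter_upwards [key] with n hn
  obtain ⟨u1, u2, u3⟩ := hn
  generalize maxPattern k α n = a at *
  generalize maxPattern k (fun i => α i + 1) n = b at *
  have u1' : (a : ℝ) ≤ b + 2 := by exact_mod_cast u1
  have u2' : (b : ℝ) ≤ a + 2 := by exact_mod_cast u2
  have u3' : (0 : ℝ) < b := by exact_mod_cast u3
  rw [Real.dist_eq, div_sub_one u3'.ne', abs_div, abs_of_pos u3']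
  gcongr
  rw [abs_le]
  constructor <;> linarith
end

section
/- For every n ≥ 5, the maximum size of a family of subsets of [n] satisfying the (⋆,⋆,0)-intersection pattern modulo 3 equals n when n ≡ 0 (mod 3), equals n − 1 when n ≡ 1 (mod 3), and equals n − 2 when n ≡ 2 (mod 3); that is, g_{(⋆,⋆,0)}(n) = n, n − 1, n − 2 in the respective cases. -/
open Finset

/-- A family `F` of subsets of `Fin n` satisfies the `α`-intersection pattern modulo 3,
where `α : Fin k → Bool` with `true` standing for `⋆` (nonzero mod 3) and `false` for `0`:
every subfamily of `i+1` distinct sets has intersection size `≢ 0 (mod 3)` if `α i = true`,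
and `≡ 0 (mod 3)` if `α i = false`. -/
def SatisfiesPattern3 (n k : ℕ) (α : Fin k → Bool) (F : Finset (Finset (Fin n))) : Prop :=
  ∀ i : Fin k, ∀ S : Finset (Finset (Fin n)), S ⊆ F → S.card = i.val + 1 →
    (if α i then (S.inf id).card % 3 ≠ 0 else (S.inf id).card % 3 = 0)

/-- `maxPattern3 k α n` is `g_α(n)`, the maximum size of a family of subsets of `[n]`
satisfying the `α`-intersection pattern modulo 3. -/
noncomputable def maxPattern3 (k : ℕ) (α : Fin k → Bool) (n : ℕ) : ℕ :=
  sSup {m : ℕ | ∃ F : Finset (Finset (Fin n)), SatisfiesPattern3 n k α F ∧ F.card = m}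

lemma card_le_aux (n : ℕ) (F : Finset (Finset (Fin n)))
    (h : SatisfiesPattern3 n 3 ![true, true, false] F) (A : Finset (Fin n)) (hA : A ∈ F) :
    F.card ≤ A.card + 1 := by
  classical
  have h2 : ∀ B ∈ F, B ≠ A → (A ∩ B).card % 3 ≠ 0 := by
    intro B hB hBA
    have := h 1 {A, B} (by intro x; simp; rintro (rfl | rfl) <;> assumption)
      (by rw [Finset.card_pair (Ne.symm hBA)]; rfl)
    simpa using this
  have h3 : ∀ B ∈ F, ∀ C ∈ F, B ≠ A → C ≠ A → B ≠ C → (A ∩ (B ∩ C)).card % 3 = 0 := by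
    intro B hB C hC hBA hCA hBC
    have := h 2 {A, B, C} (by intro x; simp; rintro (rfl | rfl | rfl) <;> assumption)
      (by rw [Finset.card_eq_three.2 ⟨A, B, C, Ne.symm hBA, Ne.symm hCA, hBC, rfl⟩]; rfl)
    simpa using this
  let v : (F.erase A) → (A → ZMod 3) := fun B x => if x.1 ∈ B.1 then 1 else 0
  have hdot : ∀ B C : F.erase A, ∑ x, v B x * v C x = ((A ∩ (B.1 ∩ C.1)).card : ZMod 3) := by
    intro B C
    have e : ∀ x : A, v B x * v C x = if x.1 ∈ B.1 ∩ C.1 then (1 : ZMod 3) else 0 := by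
      intro x
      by_cases h1 : x.1 ∈ B.1 <;> by_cases h2 : x.1 ∈ C.1 <;> simp [v, h1, h2]
    rw [Finset.sum_congr rfl (fun x _ => e x),
      Finset.sum_coe_sort A (fun x => if x ∈ B.1 ∩ C.1 then (1 : ZMod 3) else 0),
      Finset.sum_ite_mem]
    simp
  have hli : LinearIndependent (ZMod 3) v := by
    have : Fact (Nat.Prime 3) := ⟨Nat.prime_three⟩
    rw [Fintype.linearIndependent_iff]
    intro g hg C
    have hs : ∑ x, (∑ B, g B • v B) x * v C x = 0 := by rw [hg]; simp
    have hs2 : ∑ B, g B * ∑ x, v B x * v C x = 0 := by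
      rw [← hs]
      simp only [Finset.sum_apply, Pi.smul_apply, smul_eq_mul, Finset.sum_mul, Finset.mul_sum]
      rw [Finset.sum_comm]
      simp only [mul_assoc]
    rw [Finset.sum_eq_single C] at hs2
    · rw [hdot, mul_eq_zero] at hs2
      rcases hs2 with h | h
      · exact h
      · exfalso
        rw [ZMod.natCast_eq_zero_iff, Finset.inter_self] at h
        have hC := Finset.mem_erase.1 C.2
        exact h2 C.1 hC.2 hC.1 (Nat.mod_eq_zero_of_dvd h)
    · intro B _ hBC
      have hC := Finset.mem_erase.1 C.2
      have hB := Finset.mem_erase.1 B.2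
      rw [hdot, (ZMod.natCast_eq_zero_iff _ _).2 (Nat.dvd_of_mod_eq_zero
        (h3 B.1 hB.2 C.1 hC.2 hB.1 hC.1 (fun e => hBC (Subtype.ext e)))), mul_zero]
    · simp
  have : Fact (Nat.Prime 3) := ⟨Nat.prime_three⟩
  have := hli.fintype_card_le_finrank
  rw [Fintype.card_coe, Finset.card_erase_of_mem hA, Module.finrank_fintype_fun_eq_card, Fintype.card_coe] at this
  omega

lemma lower_aux (n N : ℕ) (hN : N ≤ n) (h3 : N % 3 = 0) :
    ∃ F : Finset (Finset (Fin n)), SatisfiesPattern3 n 3 ![true, true, false] F ∧ F.card = N := by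
  classical
  obtain ⟨U, -, hU⟩ := Finset.exists_subset_card_eq (s := (univ : Finset (Fin n))) (n := N)
    (by simpa using hN)
  have hinj : Set.InjOn (fun x => U.erase x) (U : Set (Fin n)) := Finset.erase_injOn U
  refine ⟨U.image (fun x => U.erase x), ?_, by rw [Finset.card_image_of_injOn hinj, hU]⟩
  intro i S hS hc
  obtain ⟨T, hT, rfl⟩ := Finset.subset_image_iff.1 hS
  have hTU : T ⊆ U := by exact_mod_cast hT
  rw [Finset.card_image_of_injOn (hinj.mono hT)] at hc
  have hne : T.Nonempty := by rw [← Finset.card_pos]; omega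
  have hinf : (T.image (fun x => U.erase x)).inf id = U \ T := by
    ext y
    obtain ⟨t, ht⟩ := hne
    simp only [Finset.inf_image, Finset.mem_inf, Function.comp, id, Finset.mem_erase,
      Finset.mem_sdiff]
    constructor
    · intro h
      exact ⟨(h t ht).2, fun hy => (h y hy).1 rfl⟩
    · rintro ⟨h1, h2⟩ x hx
      exact ⟨fun e => h2 (e ▸ hx), h1⟩
  have hle := Finset.card_le_card hTU
  rw [hinf, Finset.card_sdiff_of_subset hTU, hc, hU]
  rw [hc, hU] at hle
  fin_cases i <;> simp at hle ⊢ <;> omega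

lemma upper_aux (n : ℕ) (hn : 5 ≤ n) (F : Finset (Finset (Fin n)))
    (h : SatisfiesPattern3 n 3 ![true, true, false] F) : F.card ≤ n - n % 3 := by
  classical
  by_contra hlt
  push Not at hlt
  have h1 : ∀ B ∈ F, B.card % 3 ≠ 0 := by
    intro B hB
    have := h 0 {B} (by simpa using hB) (by simp)
    simpa using this
  have h2 : ∀ A ∈ F, ∀ B ∈ F, B ≠ A → (A ∩ B).card % 3 ≠ 0 := by
    intro A hA B hB hBA
    have := h 1 {A, B} (by intro x; simp; rintro (rfl | rfl) <;> assumption)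
      (by rw [Finset.card_pair (Ne.symm hBA)]; rfl)
    simpa using this
  have hc : ∀ B ∈ F, n - n % 3 ≤ B.card ∧ B.card ≤ n := by
    intro B hB
    have := card_le_aux n F h B hB
    have h' := Finset.card_le_univ B
    simp at h'
    omega
  have hEx : ∀ A : Finset (Fin n), ∃ B ∈ F.erase A, B ≠ univ := by
    intro A
    have : 0 < ((F.erase A).erase univ).card := by
      have := Finset.pred_card_le_card_erase (s := F) (a := A)
      have := Finset.pred_card_le_card_erase (s := F.erase A) (a := univ)
      omega
    obtain ⟨B, hB⟩ := Finset.card_pos.1 this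
    rw [Finset.mem_erase] at hB
    exact ⟨B, hB.2, hB.1⟩
  have hlt' : ∀ B : Finset (Fin n), B ≠ univ → B.card < n := by
    intro B hB
    obtain ⟨x, hx⟩ : ∃ x, x ∉ B := by
      by_contra hh; push Not at hh; exact hB (Finset.eq_univ_iff_forall.2 hh)
    simpa using Finset.card_lt_univ_of_notMem hx
  obtain ⟨A, hA, hAu⟩ := hEx univ
  obtain ⟨B, hB, hBu⟩ := hEx A
  rw [Finset.mem_erase] at hA hB
  have a1 := h1 A hA.2
  have a2 := hc A hA.2
  have a3 := hlt' A hAu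
  have b1 := h1 B hB.2
  have b2 := hc B hB.2
  have b3 := hlt' B hBu
  have ab := h2 A hA.2 B hB.2 hB.1
  have u := Finset.card_union_add_card_inter A B
  have u' := Finset.card_le_univ (A ∪ B)
  simp at u'
  have w : A.card = B.card → (A ∩ B).card < A.card := by
    intro e
    apply Finset.card_lt_card
    rw [Finset.ssubset_iff_subset_ne]
    refine ⟨Finset.inter_subset_left, fun e' => hB.1 ?_⟩
    exact (Finset.eq_of_subset_of_card_le (Finset.inter_eq_left.1 e') (by omega)).symm
  omega

lemma max_aux (n : ℕ) (hn : 5 ≤ n) : maxPattern3 3 ![true, true, false] n = n - n % 3 := by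
  apply IsGreatest.csSup_eq
  refine ⟨lower_aux n _ (by omega) (by omega), ?_⟩
  rintro m ⟨F, hF, rfl⟩
  exact upper_aux n hn F hF

theorem g_starstar0 (n : ℕ) (hn : 5 ≤ n) :
    (n % 3 = 0 → maxPattern3 3 ![true, true, false] n = n) ∧
    (n % 3 = 1 → maxPattern3 3 ![true, true, false] n = n - 1) ∧
    (n % 3 = 2 → maxPattern3 3 ![true, true, false] n = n - 2) := by
  rw [max_aux n hn]
  refine ⟨?_, ?_, ?_⟩ <;> intro h <;> omega
end
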